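/- arXiv:2310.01713 — 10 statements merged into one kernel-verified Lean document; each statement's English description precedes it below -/
import Mathlib

section
/- Convex-combination rewriting of the stabilized scheme: if ∑_{j∈𝒱} c_{ij} = 0 for the fixed index i and d_{ij} > 0 for all j ≠ i, then the update satisfies the identity U_i^{n+1} = (1 − ∑_{j≠i} 2τ d_{ij}/m_i) U_i^n + ∑_{j≠i} (2τ d_{ij}/m_i) Ū_{ij}, where Ū_{ij} := ½(U_i^n + U_j^n) − (f(U_j^n) − f(U_i^n)) c_{ij}/(2 d_{ij}). -/
open Finset Matrix

/-- Convex-combination rewriting of the stabilized scheme: if `∑ j, c i j = 0`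
for the fixed index `i` and `dvisc i j > 0` for all `j ≠ i`, then the update
can be rewritten as a combination of the current state and the bar states
`Ū_{ij} := ½(U i + U j) - (f (U j) - f (U i)) (c i j) / (2 dvisc i j)`. -/
theorem convex_combination_rewriting {m d : ℕ} {ι : Type*} [Fintype ι] [DecidableEq ι]
    (mass : ι → ℝ)
    (c : ι → ι → Fin d → ℝ)
    (dvisc : ι → ι → ℝ) (hdiag : ∀ i, dvisc i i = 0)
    (f : (Fin m → ℝ) → Matrix (Fin m) (Fin d) ℝ)
    (τ : ℝ) (hτ : 0 < τ)
    (U Unext : ι → Fin m → ℝ)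
    (hupdate : ∀ i, Unext i = U i - (τ / mass i) •
      (∑ j, (f (U j)).mulVec (c i j)
        - ∑ j ∈ Finset.univ.erase i, dvisc i j • (U j - U i)))
    (i : ι) (hmi : 0 < mass i)
    (hcsum : ∑ j, c i j = 0)
    (hdpos : ∀ j ∈ Finset.univ.erase i, 0 < dvisc i j) :
    Unext i = (1 - ∑ j ∈ Finset.univ.erase i, 2 * τ * dvisc i j / mass i) • U i
      + ∑ j ∈ Finset.univ.erase i, (2 * τ * dvisc i j / mass i) •
          ((1/2 : ℝ) • (U i + U j)
            - (2 * dvisc i j)⁻¹ • ((f (U j) - f (U i)).mulVec (c i j))) := by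
  have hflux : ∑ j, (f (U j)).mulVec (c i j)
      = ∑ j ∈ Finset.univ.erase i, (f (U j) - f (U i)).mulVec (c i j) := by
    have hzero : ∑ j, (f (U i)).mulVec (c i j) = 0 := by
      rw [← Matrix.mulVec_sum, hcsum, Matrix.mulVec_zero]
    rw [Finset.sum_erase _ (by simp)]
    simp only [Matrix.sub_mulVec, Finset.sum_sub_distrib, hzero, sub_zero]
  rw [hupdate i, hflux, ← Finset.sum_sub_distrib, Finset.smul_sum, sub_smul, one_smul,
    Finset.sum_smul, sub_add, ← Finset.sum_sub_distrib]
  congr 1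
  refine Finset.sum_congr rfl fun j hj => ?_
  have hd := (hdpos j hj).ne'
  have hm := hmi.ne'
  ext k
  simp only [Pi.smul_apply, Pi.sub_apply, Pi.add_apply, smul_eq_mul]
  field_simp
  ring
end

section
/- Invariant-set preservation under the CFL condition (core of the IDP greedy viscosity theorem): let B ⊆ ℝ^m be a convex set. Fix i ∈ 𝒱 and assume ∑_{j∈𝒱} c_{ij} = 0, d_{ij} > 0 for all j ≠ i, the CFL condition 1 − (2τ/m_i) ∑_{j≠i} d_{ij} ≥ 0, that U_i^n ∈ B, and that every bar state Ū_{ij} := ½(U_i^n + U_j^n) − (f(U_j^n) − f(U_i^n)) c_{ij}/(2 d_{ij}) (j ≠ i) belongs to B. Then U_i^{n+1} ∈ B. -/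
open Finset Matrix

/-- A convex set containing `x` and the `z j` contains their convex combination in which `x`
carries the weight left over by the `w j`. -/
theorem Convex.one_sub_sum_smul_add_sum_mem {E κ : Type*} [AddCommGroup E] [Module ℝ E]
    {B : Set E} (hB : Convex ℝ B) {s : Finset κ} {w : κ → ℝ} {z : κ → E} {x : E}
    (hx : x ∈ B) (hw : ∀ j ∈ s, 0 ≤ w j) (hsum : ∑ j ∈ s, w j ≤ 1) (hz : ∀ j ∈ s, z j ∈ B) :
    (1 - ∑ j ∈ s, w j) • x + ∑ j ∈ s, w j • z j ∈ B := by
  have h := hB.sum_mem (t := insertNone s) (w := fun o => o.elim (1 - ∑ j ∈ s, w j) w)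
    (z := fun o => o.elim x z)
    (by rw [forall_mem_insertNone]; exact ⟨sub_nonneg.2 hsum, hw⟩)
    (by simp [sum_insertNone])
    (by rw [forall_mem_insertNone]; exact ⟨hx, hz⟩)
  simpa [sum_insertNone] using h

/-- If the vectors `c j` sum to zero, the flux sum may be centred at the state of index `i`. -/
theorem sum_mulVec_eq_sum_erase_sub_mulVec {m d : ℕ} {ι : Type*} [Fintype ι] [DecidableEq ι]
    (A : ι → Matrix (Fin m) (Fin d) ℝ) (c : ι → Fin d → ℝ) (i : ι) (hc : ∑ j, c j = 0) :
    ∑ j, (A j).mulVec (c j) = ∑ j ∈ univ.erase i, (A j - A i).mulVec (c j) := by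
  rw [sum_erase _ (by simp)]
  simp only [sub_mulVec, sum_sub_distrib]
  rw [← mulVec_sum, hc, mulVec_zero, sub_zero]

/-- Invariant-set preservation under the CFL condition: let `B ⊆ ℝ^m` be
convex, assume `∑ j, c i j = 0`, `dvisc i j > 0` for `j ≠ i`, the CFL
condition, `U i ∈ B` and that every bar state
`Ū_{ij} := ½(U i + U j) - (f (U j) - f (U i)) (c i j) / (2 dvisc i j)` is
in `B`.  Then the update `U^{n+1} i` belongs to `B`. -/
theorem invariant_set_preservation {m d : ℕ} {ι : Type*} [Fintype ι] [DecidableEq ι]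
    (mass : ι → ℝ)
    (c : ι → ι → Fin d → ℝ)
    (dvisc : ι → ι → ℝ) (hdiag : ∀ i, dvisc i i = 0)
    (f : (Fin m → ℝ) → Matrix (Fin m) (Fin d) ℝ)
    (τ : ℝ) (hτ : 0 < τ)
    (U Unext : ι → Fin m → ℝ)
    (hupdate : ∀ i, Unext i = U i - (τ / mass i) •
      (∑ j, (f (U j)).mulVec (c i j)
        - ∑ j ∈ Finset.univ.erase i, dvisc i j • (U j - U i)))
    (B : Set (Fin m → ℝ)) (hB : Convex ℝ B)
    (i : ι) (hmi : 0 < mass i)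
    (hcsum : ∑ j, c i j = 0)
    (hdpos : ∀ j ∈ Finset.univ.erase i, 0 < dvisc i j)
    (hcfl : 0 ≤ 1 - (2 * τ / mass i) * ∑ j ∈ Finset.univ.erase i, dvisc i j)
    (hUi : U i ∈ B)
    (hbar : ∀ j ∈ Finset.univ.erase i,
      (1/2 : ℝ) • (U i + U j)
        - (2 * dvisc i j)⁻¹ • ((f (U j) - f (U i)).mulVec (c i j)) ∈ B) :
    Unext i ∈ B := by
  have hk : 0 ≤ τ / mass i := (div_pos hτ hmi).le
  have hcfl' : ∑ j ∈ univ.erase i, 2 * (τ / mass i) * dvisc i j ≤ 1 := by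
    rw [← mul_sum]
    rw [mul_div_assoc] at hcfl
    linarith
  convert hB.one_sub_sum_smul_add_sum_mem hUi
    (fun j hj => mul_nonneg (mul_nonneg zero_le_two hk) (hdpos j hj).le) hcfl' hbar using 1
  have hterm : ∀ j ∈ univ.erase i,
      (2 * (τ / mass i) * dvisc i j) • ((1/2 : ℝ) • (U i + U j)
        - (2 * dvisc i j)⁻¹ • ((f (U j) - f (U i)).mulVec (c i j)))
      = (2 * (τ / mass i) * dvisc i j) • U i
        - (τ / mass i) • ((f (U j) - f (U i)).mulVec (c i j) - dvisc i j • (U j - U i)) := by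
    intro j hj
    have hne := (hdpos j hj).ne'
    have hcoef : 2 * (τ / mass i) * dvisc i j * (2 * dvisc i j)⁻¹ = τ / mass i := by
      field_simp
    rw [smul_sub, smul_smul _ (2 * dvisc i j)⁻¹, hcoef]
    module
  rw [sum_congr rfl hterm, sum_sub_distrib, ← sum_smul, ← smul_sum, sum_sub_distrib, hupdate,
    sum_mulVec_eq_sum_erase_sub_mulVec (fun j => f (U j)) (c i) i hcsum]
  module
end

section
/- Discrete entropy inequality for the stabilized scheme (second assertion of the IDP greedy viscosity theorem): let η : ℝ^m → ℝ be convex and q : ℝ^m → ℝ^d. Fix i ∈ 𝒱 and assume ∑_{j∈𝒱} c_{ij} = 0, d_{ij} > 0 for all j ≠ i, the CFL condition 1 − (2τ/m_i) ∑_{j≠i} d_{ij} ≥ 0, and that each bar state Ū_{ij} := ½(U_i^n + U_j^n) − (f(U_j^n) − f(U_i^n)) c_{ij}/(2 d_{ij}) satisfies 2 d_{ij} η(Ū_{ij}) ≤ d_{ij}(η(U_i^n) + η(U_j^n)) − (q(U_j^n) − q(U_i^n))·c_{ij} for all j ≠ i. Then (m_i/τ)(η(U_i^{n+1}) − η(U_i^n))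 + ∑_{j∈𝒱} c_{ij}·q(U_j^n) − ∑_{j≠i} d_{ij}(η(U_j^n) − η(U_i^n)) ≤ 0. -/
open Finset Matrix

/-- Discrete entropy inequality for the stabilized scheme: if `η` is convex,
`∑ j, c i j = 0`, `dvisc i j > 0` for `j ≠ i`, the CFL condition holds and
each bar state `Ū_{ij}` satisfies
`2 dᵢⱼ η(Ūᵢⱼ) ≤ dᵢⱼ(η(Uᵢ)+η(Uⱼ)) - (q(Uⱼ)-q(Uᵢ))·cᵢⱼ`, then the update
satisfies the discrete entropy inequality. -/
theorem discrete_entropy_inequality {m d : ℕ} {ι : Type*} [Fintype ι] [DecidableEq ι]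
    (mass : ι → ℝ)
    (c : ι → ι → Fin d → ℝ)
    (dvisc : ι → ι → ℝ) (hdiag : ∀ i, dvisc i i = 0)
    (f : (Fin m → ℝ) → Matrix (Fin m) (Fin d) ℝ)
    (τ : ℝ) (hτ : 0 < τ)
    (U Unext : ι → Fin m → ℝ)
    (hupdate : ∀ i, Unext i = U i - (τ / mass i) •
      (∑ j, (f (U j)).mulVec (c i j)
        - ∑ j ∈ Finset.univ.erase i, dvisc i j • (U j - U i)))
    (η : (Fin m → ℝ) → ℝ) (hη : ConvexOn ℝ Set.univ η)
    (q : (Fin m → ℝ) → Fin d → ℝ)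
    (i : ι) (hmi : 0 < mass i)
    (hcsum : ∑ j, c i j = 0)
    (hdpos : ∀ j ∈ Finset.univ.erase i, 0 < dvisc i j)
    (hcfl : 0 ≤ 1 - (2 * τ / mass i) * ∑ j ∈ Finset.univ.erase i, dvisc i j)
    (hbar : ∀ j ∈ Finset.univ.erase i,
      2 * dvisc i j * η ((1/2 : ℝ) • (U i + U j)
          - (2 * dvisc i j)⁻¹ • ((f (U j) - f (U i)).mulVec (c i j)))
        ≤ dvisc i j * (η (U i) + η (U j)) - (q (U j) - q (U i)) ⬝ᵥ c i j) :
    mass i / τ * (η (Unext i) - η (U i)) + ∑ j, c i j ⬝ᵥ q (U j)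
      - ∑ j ∈ Finset.univ.erase i, dvisc i j * (η (U j) - η (U i)) ≤ 0 := by
  have hf : ∑ j ∈ Finset.univ.erase i, (f (U j) - f (U i)).mulVec (c i j)
      = ∑ j, (f (U j)).mulVec (c i j) := by
    rw [Finset.sum_erase _ (by simp)]
    simp only [Matrix.sub_mulVec, Finset.sum_sub_distrib]
    rw [← Matrix.mulVec_sum, hcsum, Matrix.mulVec_zero, sub_zero]
  have hq : ∑ j ∈ Finset.univ.erase i, (q (U j) - q (U i)) ⬝ᵥ c i j
      = ∑ j, c i j ⬝ᵥ q (U j) := by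
    rw [Finset.sum_erase _ (by simp)]
    simp only [sub_dotProduct, Finset.sum_sub_distrib]
    rw [← dotProduct_sum, hcsum, dotProduct_zero, sub_zero]
    exact Finset.sum_congr rfl fun j _ => dotProduct_comm _ _
  set bar : ι → Fin m → ℝ := fun j => (1/2 : ℝ) • (U i + U j)
    - (2 * dvisc i j)⁻¹ • ((f (U j) - f (U i)).mulVec (c i j)) with hbar_def
  set v : ℝ := 1 - (2 * τ / mass i) * ∑ j ∈ Finset.univ.erase i, dvisc i j with hv
  have hw : v + ∑ j ∈ Finset.univ.erase i, 2 * τ / mass i * dvisc i j = 1 := by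
    rw [← Finset.mul_sum, hv]
    ring
  have hcomb : Unext i
      = v • U i + ∑ j ∈ Finset.univ.erase i, (2 * τ / mass i * dvisc i j) • bar j := by
    have hterm : ∀ j ∈ Finset.univ.erase i, (2 * τ / mass i * dvisc i j) • bar j
        = (2 * τ / mass i * dvisc i j) • U i + (τ / mass i) • (dvisc i j • (U j - U i))
          - (τ / mass i) • (f (U j) - f (U i)).mulVec (c i j) := by
      intro j hj
      have hd := (hdpos j hj).ne'
      ext k
      simp only [hbar_def, Pi.smul_apply, Pi.add_apply, Pi.sub_apply, smul_eq_mul]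
      field_simp
      ring
    rw [Finset.sum_congr rfl hterm, Finset.sum_sub_distrib, Finset.sum_add_distrib,
      ← Finset.sum_smul, ← Finset.smul_sum, ← Finset.smul_sum, hf, hupdate i,
      eq_sub_of_add_eq hw]
    module
  have hconv : η (Unext i)
      ≤ v * η (U i) + ∑ j ∈ Finset.univ.erase i, 2 * τ / mass i * dvisc i j * η (bar j) := by
    rw [hcomb]
    exact hη.map_add_sum_le
      (fun j hj => mul_nonneg (by positivity) (hdpos j hj).le) hw
      (fun _ _ => Set.mem_univ _) hcfl (Set.mem_univ _)
  have hscaled : mass i / τ * (η (Unext i) - η (U i))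
      ≤ ∑ j ∈ Finset.univ.erase i, (2 * dvisc i j * η (bar j) - 2 * dvisc i j * η (U i)) := by
    calc mass i / τ * (η (Unext i) - η (U i))
        ≤ mass i / τ * (v * η (U i)
            + ∑ j ∈ Finset.univ.erase i, 2 * τ / mass i * dvisc i j * η (bar j) - η (U i)) := by
          gcongr
      _ = mass i / τ * ∑ j ∈ Finset.univ.erase i,
            (2 * τ / mass i * dvisc i j * η (bar j) - 2 * τ / mass i * dvisc i j * η (U i)) := by
          rw [Finset.sum_sub_distrib, ← Finset.sum_mul, eq_sub_of_add_eq hw]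
          ring
      _ = _ := by
          rw [Finset.mul_sum]
          refine Finset.sum_congr rfl fun j _ => ?_
          field_simp
  have hsum : ∑ j ∈ Finset.univ.erase i, (2 * dvisc i j * η (bar j) - 2 * dvisc i j * η (U i))
      ≤ ∑ j ∈ Finset.univ.erase i, (dvisc i j * (η (U j) - η (U i))
          - (q (U j) - q (U i)) ⬝ᵥ c i j) :=
    Finset.sum_le_sum fun j hj => by linarith [hbar j hj]
  have hsplit : ∑ j ∈ Finset.univ.erase i, (dvisc i j * (η (U j) - η (U i))
      - (q (U j) - q (U i)) ⬝ᵥ c i j)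
      = ∑ j ∈ Finset.univ.erase i, dvisc i j * (η (U j) - η (U i)) - ∑ j, c i j ⬝ᵥ q (U j) := by
    rw [Finset.sum_sub_distrib, hq]
  linarith
end

section
/- Segment structure of bar states (key step in Lemma 3.3(i)): let 0 < λ₁ < λ₂ and λ ∈ [λ₁, λ₂]. Set θ := ((λ₂ − λ)λ₁)/((λ₂ − λ₁)λ). Then θ ∈ [0,1] and ū(λ) = θ ū(λ₁) + (1 − θ) ū(λ₂). Consequently, if B ⊆ ℝ^m is convex with ū(λ₁) ∈ B and ū(λ₂) ∈ B, then ū(λ) ∈ B for every λ ∈ [λ₁, λ₂]. -/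
open Matrix

/-- The bar state `ū(λ) := ½(u_L + u_R) - (1/(2λ))(f(u_R) - f(u_L)) n`. -/
noncomputable def ubar {m d : ℕ} (f : (Fin m → ℝ) → Matrix (Fin m) (Fin d) ℝ)
    (n : Fin d → ℝ) (uL uR : Fin m → ℝ) (lam : ℝ) : Fin m → ℝ :=
  (1/2 : ℝ) • (uL + uR) - (1/(2*lam)) • ((f uR - f uL).mulVec n)

theorem barstate_weight_mem_Icc {lam1 lam2 lam : ℝ} (h1 : 0 < lam1) (h12 : lam1 < lam2)
    (hlam : lam ∈ Set.Icc lam1 lam2) :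
    ((lam2 - lam) * lam1) / ((lam2 - lam1) * lam) ∈ Set.Icc (0:ℝ) 1 := by
  obtain ⟨hl, hu⟩ := hlam
  have hpos : 0 < (lam2 - lam1) * lam := mul_pos (sub_pos.2 h12) (h1.trans_le hl)
  refine ⟨div_nonneg (mul_nonneg (sub_nonneg.2 hu) h1.le) hpos.le, (div_le_one hpos).2 ?_⟩
  nlinarith [mul_nonneg (sub_nonneg.2 hl) (h1.trans h12).le]

theorem ubar_eq_weighted_sum {m d : ℕ} (f : (Fin m → ℝ) → Matrix (Fin m) (Fin d) ℝ)
    (n : Fin d → ℝ) (uL uR : Fin m → ℝ) {lam1 lam2 lam : ℝ}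
    (h1 : lam1 ≠ 0) (h2 : lam2 ≠ 0) (h12 : lam1 ≠ lam2) (h : lam ≠ 0) :
    ubar f n uL uR lam
      = (((lam2 - lam) * lam1) / ((lam2 - lam1) * lam)) • ubar f n uL uR lam1
        + (1 - ((lam2 - lam) * lam1) / ((lam2 - lam1) * lam)) • ubar f n uL uR lam2 := by
  have hd : lam2 - lam1 ≠ 0 := sub_ne_zero.2 h12.symm
  ext i
  simp only [ubar, Pi.add_apply, Pi.sub_apply, Pi.smul_apply, smul_eq_mul]
  field_simp
  ring

/-- Segment structure of bar states: for `0 < λ₁ < λ₂` and `λ ∈ [λ₁, λ₂]`,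
with `θ := ((λ₂ - λ)λ₁)/((λ₂ - λ₁)λ)` one has `θ ∈ [0,1]` and
`ū(λ) = θ ū(λ₁) + (1 - θ) ū(λ₂)`; consequently any convex set containing
`ū(λ₁)` and `ū(λ₂)` contains `ū(λ)` for every `λ ∈ [λ₁, λ₂]`. -/
theorem barstate_segment {m d : ℕ} (uL uR : Fin m → ℝ) (n : Fin d → ℝ) (hn : n ⬝ᵥ n = 1)
    (f : (Fin m → ℝ) → Matrix (Fin m) (Fin d) ℝ)
    (lam1 lam2 lam : ℝ) (h1 : 0 < lam1) (h12 : lam1 < lam2)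
    (hlam : lam ∈ Set.Icc lam1 lam2) :
    ((lam2 - lam) * lam1) / ((lam2 - lam1) * lam) ∈ Set.Icc (0:ℝ) 1 ∧
    ubar f n uL uR lam
      = (((lam2 - lam) * lam1) / ((lam2 - lam1) * lam)) • ubar f n uL uR lam1
        + (1 - ((lam2 - lam) * lam1) / ((lam2 - lam1) * lam)) • ubar f n uL uR lam2 ∧
    ∀ B : Set (Fin m → ℝ), Convex ℝ B →
      ubar f n uL uR lam1 ∈ B → ubar f n uL uR lam2 ∈ B →
      ∀ μ ∈ Set.Icc lam1 lam2, ubar f n uL uR μ ∈ B := by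
  have hpos : ∀ μ ∈ Set.Icc lam1 lam2, μ ≠ 0 := fun μ hμ => (h1.trans_le hμ.1).ne'
  have hsum : ∀ μ ∈ Set.Icc lam1 lam2, _ := fun μ hμ =>
    ubar_eq_weighted_sum f n uL uR h1.ne' (h1.trans h12).ne' h12.ne (hpos μ hμ)
  refine ⟨barstate_weight_mem_Icc h1 h12 hlam, hsum lam hlam, fun B hB hB1 hB2 μ hμ => ?_⟩
  obtain ⟨hw0, hw1⟩ := barstate_weight_mem_Icc h1 h12 hμ
  rw [hsum μ hμ]
  exact hB hB1 hB2 hw0 (sub_nonneg.2 hw1) (add_sub_cancel _ _)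
end

section
/- Propagation of the entropy inequality between two wave speeds (Lemma 3.3(ii)): let η : ℝ^m → ℝ be convex, q : ℝ^m → ℝ^d, 0 < λ_e ≤ λ^♯, and define Φ(t) := η(ū(1/t)) − ½(η(u_L) + η(u_R)) + (t/2)(q(u_R) − q(u_L))·n. If Φ(1/λ_e) ≤ 0 and Φ(1/λ^♯) ≤ 0, then Φ(1/λ) ≤ 0 for every λ ∈ [λ_e, λ^♯]. -/
open Matrix

theorem ubar_one_div {m d : ℕ} (f : (Fin m → ℝ) → Matrix (Fin m) (Fin d) ℝ)
    (n : Fin d → ℝ) (uL uR : Fin m → ℝ) (t : ℝ) :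
    ubar f n uL uR (1/t) = AffineMap.lineMap ((1/2 : ℝ) • (uL + uR))
      ((1/2 : ℝ) • (uL + uR) - (1/2 : ℝ) • ((f uR - f uL).mulVec n)) t := by
  have ht : 1 / (2 * (1/t)) = t * (1/2) := by
    rw [one_div, mul_inv, one_div, inv_inv]; ring
  rw [ubar, ht, AffineMap.lineMap_apply_module']
  module

theorem convexOn_eta_ubar_one_div {m d : ℕ} (f : (Fin m → ℝ) → Matrix (Fin m) (Fin d) ℝ)
    (n : Fin d → ℝ) (uL uR : Fin m → ℝ) {η : (Fin m → ℝ) → ℝ}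
    (hη : ConvexOn ℝ Set.univ η) :
    ConvexOn ℝ Set.univ fun t : ℝ => η (ubar f n uL uR (1/t)) := by
  simp only [ubar_one_div]
  exact hη.comp_affineMap _

/-- Propagation of the entropy inequality between two wave speeds: with
`Φ(t) := η(ū(1/t)) - ½(η(u_L) + η(u_R)) + (t/2)(q(u_R) - q(u_L))·n`,
if `η` is convex, `0 < λ_e ≤ λ♯`, `Φ(1/λ_e) ≤ 0` and `Φ(1/λ♯) ≤ 0`, then
`Φ(1/λ) ≤ 0` for every `λ ∈ [λ_e, λ♯]`. -/
theorem entropy_inequality_propagation {m d : ℕ}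
    (uL uR : Fin m → ℝ) (n : Fin d → ℝ) (hn : n ⬝ᵥ n = 1)
    (f : (Fin m → ℝ) → Matrix (Fin m) (Fin d) ℝ)
    (η : (Fin m → ℝ) → ℝ) (hη : ConvexOn ℝ Set.univ η)
    (q : (Fin m → ℝ) → Fin d → ℝ)
    (Phi : ℝ → ℝ)
    (hPhi : ∀ t : ℝ, Phi t = η (ubar f n uL uR (1/t))
      - (1/2) * (η uL + η uR) + t/2 * ((q uR - q uL) ⬝ᵥ n))
    (lamE lamSharp : ℝ) (h0 : 0 < lamE) (hes : lamE ≤ lamSharp)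
    (hE : Phi (1/lamE) ≤ 0) (hS : Phi (1/lamSharp) ≤ 0) :
    ∀ lam ∈ Set.Icc lamE lamSharp, Phi (1/lam) ≤ 0 := by
  intro lam hlam
  have hlam0 : 0 < lam := h0.trans_le hlam.1
  have hconv : ConvexOn ℝ Set.univ Phi := by
    refine ⟨convex_univ, fun x _ y _ a b ha hb hab => ?_⟩
    have h := (convexOn_eta_ubar_one_div f n uL uR hη).2
      (Set.mem_univ x) (Set.mem_univ y) ha hb hab
    simp only [hPhi, smul_eq_mul] at h ⊢
    obtain rfl : b = 1 - a := by linarith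
    linarith
  have hmem : 1/lam ∈ segment ℝ (1/lamSharp) (1/lamE) := by
    rw [segment_eq_Icc (one_div_le_one_div_of_le h0 hes)]
    exact ⟨one_div_le_one_div_of_le hlam0 hlam.2, one_div_le_one_div_of_le h0 hlam.1⟩
  exact (hconv.le_on_segment (Set.mem_univ _) (Set.mem_univ _) hmem).trans (max_le hS hE)
end

section
/- Scalar maximum principle wave speed (Lemma 4.1): let u_L, u_R ∈ ℝ, let f : ℝ → ℝ^d be differentiable, let n ∈ ℝ^d be a unit vector, and let λ_ε > 0. Define λ₁₂ := |(f(u_R) − f(u_L))·n|/|u_R − u_L| if u_R ≠ u_L, and λ₁₂ := max(|f'(u_L)·n|, |f'(u_R)·n|) if u_R = u_L. Then for every λ ≥ max(λ₁₂, λ_ε), the bar state ū(λ) := ½(u_L + u_R) − (1/(2λ))(f(u_R) − f(u_L))·n satisfies min(u_L, u_R) ≤ ū(λ) ≤ max(u_L, u_R). -/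
open Matrix

/-- The scalar bar state `ū(λ) := ½(u_L + u_R) - (1/(2λ))(f(u_R) - f(u_L))·n`. -/
noncomputable def ubarS {d : ℕ} (f : ℝ → Fin d → ℝ) (n : Fin d → ℝ)
    (uL uR lam : ℝ) : ℝ :=
  (uL + uR)/2 - (1/(2*lam)) * ((f uR - f uL) ⬝ᵥ n)

/-- The (Roe) wave speed `λ₁₂`. -/
noncomputable def lam12 {d : ℕ} (f : ℝ → Fin d → ℝ) (n : Fin d → ℝ)
    (uL uR : ℝ) : ℝ :=
  if uR ≠ uL then |(f uR - f uL) ⬝ᵥ n| / |uR - uL|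
  else max |deriv f uL ⬝ᵥ n| |deriv f uR ⬝ᵥ n|

/-- Scalar maximum principle wave speed (Lemma 4.1): for every
`λ ≥ max(λ₁₂, λ_ε)` the bar state `ū(λ)` lies between `min(u_L,u_R)`
and `max(u_L,u_R)`. -/
theorem scalar_maximum_principle {d : ℕ} (uL uR : ℝ)
    (f : ℝ → Fin d → ℝ) (hf : Differentiable ℝ f)
    (n : Fin d → ℝ) (hn : n ⬝ᵥ n = 1)
    (lamEps : ℝ) (hlamEps : 0 < lamEps) :
    ∀ lam : ℝ, max (lam12 f n uL uR) lamEps ≤ lam →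
      ubarS f n uL uR lam ∈ Set.Icc (min uL uR) (max uL uR) := by
  intro lam hlam
  obtain ⟨hspeed, heps⟩ := max_le_iff.mp hlam
  have hpos : 0 < lam := hlamEps.trans_le heps
  have hflux : |(f uR - f uL) ⬝ᵥ n| ≤ lam * |uR - uL| := by
    by_cases h : uR = uL
    · simp [h]
    · rw [lam12, if_pos h] at hspeed
      exact (div_le_iff₀ (abs_pos.mpr (sub_ne_zero.mpr h))).mp hspeed
  have hshift : |1 / (2 * lam) * ((f uR - f uL) ⬝ᵥ n)| ≤ |uR - uL| / 2 := by
    rw [abs_mul, abs_of_pos (by positivity), div_mul_eq_mul_div, one_mul,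
      div_le_iff₀ (by positivity)]
    linarith
  obtain ⟨hlower, hupper⟩ := abs_le.mp hshift
  rw [ubarS, Set.mem_Icc]
  rcases le_total uL uR with h | h
  · rw [abs_of_nonneg (sub_nonneg.mpr h)] at hlower hupper
    rw [min_eq_left h, max_eq_right h]
    constructor <;> linarith
  · rw [abs_of_nonpos (sub_nonpos.mpr h)] at hlower hupper
    rw [min_eq_right h, max_eq_left h]
    constructor <;> linarith
end

section
/- Kružkov entropy equality outside the Riemann range (case (1) of Lemma 4.2): let u_L, u_R ∈ ℝ with u_L ≠ u_R, f : ℝ → ℝ^d, n ∈ ℝ^d a unit vector, λ_ε > 0, and k ∈ ℝ with k ∉ (min(u_L,u_R), max(u_L,u_R)). Then for every λ ≥ max(λ₁₂, λ_ε), η_k(ū(λ)) = ½(η_k(u_L) + η_k(u_R)) − (1/(2λ))(q_k(u_R) − q_k(u_L))·n, where λ₁₂ := |(f(u_R) − f(u_L))·n|/|u_R − u_L|. -/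
open Matrix

/-- The Kružkov entropy `η_k(u) := |u - k|`. -/
noncomputable def kruzEta (k u : ℝ) : ℝ := |u - k|

/-- The Kružkov entropy flux `q_k(u) := sign(u - k)(f(u) - f(k))`. -/
noncomputable def kruzQ {d : ℕ} (f : ℝ → Fin d → ℝ) (k u : ℝ) : Fin d → ℝ :=
  Real.sign (u - k) • (f u - f k)

theorem kruzQ_of_le {d : ℕ} (f : ℝ → Fin d → ℝ) {k u : ℝ} (h : k ≤ u) :
    kruzQ f k u = f u - f k := by
  rcases h.eq_or_lt with rfl | h
  · simp [kruzQ]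
  · rw [kruzQ, Real.sign_of_pos (sub_pos.2 h), one_smul]

theorem kruzQ_of_ge {d : ℕ} (f : ℝ → Fin d → ℝ) {k u : ℝ} (h : u ≤ k) :
    kruzQ f k u = -(f u - f k) := by
  rcases h.eq_or_lt with rfl | h
  · simp [kruzQ]
  · rw [kruzQ, Real.sign_of_neg (sub_neg.2 h), neg_one_smul]

theorem ubarS_mem_Icc {d : ℕ} (f : ℝ → Fin d → ℝ) (n : Fin d → ℝ) {uL uR lam : ℝ}
    (hne : uL ≠ uR) (hlam : 0 < lam) (h : |(f uR - f uL) ⬝ᵥ n| / |uR - uL| ≤ lam) :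
    ubarS f n uL uR lam ∈ Set.Icc (min uL uR) (max uL uR) := by
  have hpos : 0 < |uR - uL| := abs_pos.2 (sub_ne_zero.2 hne.symm)
  rw [div_le_iff₀ hpos] at h
  have hb : |1 / (2 * lam) * ((f uR - f uL) ⬝ᵥ n)| ≤ |uR - uL| / 2 := by
    rw [abs_mul, abs_of_pos (by positivity : 0 < 1 / (2 * lam)), one_div_mul_eq_div,
      div_le_iff₀ (by positivity)]
    linarith
  obtain ⟨h₁, h₂⟩ := abs_le.1 hb
  unfold ubarS
  rcases le_total uL uR with hle | hle
  · rw [abs_of_nonneg (sub_nonneg.2 hle)] at h₁ h₂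
    rw [min_eq_left hle, max_eq_right hle]
    constructor <;> linarith
  · rw [abs_of_nonpos (sub_nonpos.2 hle)] at h₁ h₂
    rw [min_eq_right hle, max_eq_left hle]
    constructor <;> linarith

/-- Kružkov entropy equality outside the Riemann range (case (1) of Lemma 4.2):
if `u_L ≠ u_R` and `k ∉ (min(u_L,u_R), max(u_L,u_R))`, then for every
`λ ≥ max(λ₁₂, λ_ε)` with `λ₁₂ := |(f(u_R)-f(u_L))·n|/|u_R-u_L|`,
`η_k(ū(λ)) = ½(η_k(u_L) + η_k(u_R)) - (1/(2λ))(q_k(u_R) - q_k(u_L))·n`. -/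
theorem kruzkov_equality_outside_range {d : ℕ} (uL uR : ℝ) (hne : uL ≠ uR)
    (f : ℝ → Fin d → ℝ) (n : Fin d → ℝ) (hn : n ⬝ᵥ n = 1)
    (lamEps : ℝ) (hlamEps : 0 < lamEps)
    (k : ℝ) (hk : k ∉ Set.Ioo (min uL uR) (max uL uR)) :
    ∀ lam : ℝ, max (|(f uR - f uL) ⬝ᵥ n| / |uR - uL|) lamEps ≤ lam →
      kruzEta k (ubarS f n uL uR lam)
        = (1/2) * (kruzEta k uL + kruzEta k uR)
          - (1/(2*lam)) * ((kruzQ f k uR - kruzQ f k uL) ⬝ᵥ n) := by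
  intro lam hlam
  obtain ⟨hspeed, hEps⟩ := max_le_iff.1 hlam
  obtain ⟨hmin, hmax⟩ := ubarS_mem_Icc f n hne (hlamEps.trans_le hEps) hspeed
  rcases le_or_gt k (min uL uR) with hlow | hlow
  · obtain ⟨hL, hR⟩ := le_min_iff.1 hlow
    rw [kruzQ_of_le f hL, kruzQ_of_le f hR, sub_sub_sub_cancel_right]
    simp only [kruzEta]
    rw [abs_of_nonneg (sub_nonneg.2 hL), abs_of_nonneg (sub_nonneg.2 hR),
      abs_of_nonneg (sub_nonneg.2 (hlow.trans hmin)), ubarS]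
    ring
  · have hhigh : max uL uR ≤ k := not_lt.1 fun h => hk ⟨hlow, h⟩
    obtain ⟨hL, hR⟩ := max_le_iff.1 hhigh
    rw [kruzQ_of_ge f hL, kruzQ_of_ge f hR, ← neg_sub', sub_sub_sub_cancel_right,
      neg_dotProduct]
    simp only [kruzEta]
    rw [abs_of_nonpos (sub_nonpos.2 hL), abs_of_nonpos (sub_nonpos.2 hR),
      abs_of_nonpos (sub_nonpos.2 (hmax.trans hhigh)), ubarS]
    ring
end

section
/- Entropy wave speed for scalar equations (Lemma 4.2): let u_L, u_R ∈ ℝ, f : ℝ → ℝ^d differentiable, n ∈ ℝ^d a unit vector, λ_ε > 0, and k ∈ ℝ. Set a_k := u_L + u_R − 2k, b := (f(u_R) − f(u_L))·n, c_k := η_k(u_L) + η_k(u_R), d_k := (q_k(u_R) − q_k(u_L))·n, and let λ₁₂ := |b|/|u_R − u_L| if u_R ≠ u_L, λ₁₂ := max(|f'(u_L)·n|, |f'(u_R)·n|) otherwise. Define λ(k) := λ₁₂ if k ∉ (min(u_L,u_R), max(u_L,u_R)), and λ(k) := max((d_k + b)/(c_k + a_k), (d_k − b)/(c_k − a_k),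 λ₁₂) otherwise. Then for every λ ≥ max(λ(k), λ_ε): η_k(ū(λ)) − ½(η_k(u_L) + η_k(u_R)) + (1/(2λ))(q_k(u_R) − q_k(u_L))·n ≤ 0. -/
open Matrix

/-- The entropy wave speed `λ(k)` of Lemma 4.2, built from
`a_k := u_L + u_R - 2k`, `b := (f(u_R) - f(u_L))·n`,
`c_k := η_k(u_L) + η_k(u_R)`, `d_k := (q_k(u_R) - q_k(u_L))·n`. -/
noncomputable def lamK {d : ℕ} (f : ℝ → Fin d → ℝ) (k : ℝ) (n : Fin d → ℝ)
    (uL uR : ℝ) : ℝ :=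
  if k ∈ Set.Ioo (min uL uR) (max uL uR) then
    max (max
      ((((kruzQ f k uR - kruzQ f k uL) ⬝ᵥ n) + (f uR - f uL) ⬝ᵥ n)
        / ((kruzEta k uL + kruzEta k uR) + (uL + uR - 2*k)))
      ((((kruzQ f k uR - kruzQ f k uL) ⬝ᵥ n) - (f uR - f uL) ⬝ᵥ n)
        / ((kruzEta k uL + kruzEta k uR) - (uL + uR - 2*k))))
      (lam12 f n uL uR)
  else lam12 f n uL uR

lemma kruzQ_dotProduct_of_le {d : ℕ} (f : ℝ → Fin d → ℝ) (n : Fin d → ℝ) {k u : ℝ}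
    (h : k ≤ u) : kruzQ f k u ⬝ᵥ n = f u ⬝ᵥ n - f k ⬝ᵥ n := by
  rcases h.eq_or_lt with rfl | h
  · simp [kruzQ]
  · simp [kruzQ, Real.sign_of_pos (sub_pos.2 h), sub_dotProduct]

lemma kruzQ_dotProduct_of_ge {d : ℕ} (f : ℝ → Fin d → ℝ) (n : Fin d → ℝ) {k u : ℝ}
    (h : u ≤ k) : kruzQ f k u ⬝ᵥ n = f k ⬝ᵥ n - f u ⬝ᵥ n := by
  rcases h.eq_or_lt with rfl | h
  · simp [kruzQ]
  · simp [kruzQ, Real.sign_of_neg (sub_neg.2 h), sub_dotProduct]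

/-- The wave speed `λ₁₂` bounds the jump of the normal flux. -/
lemma abs_jump_le_of_lam12_le {d : ℕ} (f : ℝ → Fin d → ℝ) (n : Fin d → ℝ) {uL uR lam : ℝ}
    (h : lam12 f n uL uR ≤ lam) : |(f uR - f uL) ⬝ᵥ n| ≤ lam * |uR - uL| := by
  by_cases hu : uR = uL
  · simp [hu]
  · rw [lam12, if_pos hu] at h
    exact (div_le_iff₀ (abs_pos.2 (sub_ne_zero.2 hu))).1 h

lemma lam12_le_lamK {d : ℕ} (f : ℝ → Fin d → ℝ) (k : ℝ) (n : Fin d → ℝ) (uL uR : ℝ) :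
    lam12 f n uL uR ≤ lamK f k n uL uR := by
  unfold lamK
  split_ifs
  · exact le_max_right _ _
  · exact le_rfl

/-- After multiplication by `2λ` the entropy inequality reads `|λ a_k - b| ≤ λ c_k - d_k`. -/
lemma entropy_ineq_of_abs_le {d : ℕ} (f : ℝ → Fin d → ℝ) (n : Fin d → ℝ)
    {uL uR lam c D : ℝ} (k : ℝ) (hlam : 0 < lam)
    (h : |lam * (uL + uR - 2 * k) - (f uR - f uL) ⬝ᵥ n| ≤ lam * c - D) :
    kruzEta k (ubarS f n uL uR lam) - (1/2) * c + (1/(2*lam)) * D ≤ 0 := by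
  have hu : ubarS f n uL uR lam - k
      = (lam * (uL + uR - 2 * k) - (f uR - f uL) ⬝ᵥ n) / (2 * lam) := by
    unfold ubarS
    field_simp
    ring
  have hpos : 0 < 2 * lam := by positivity
  have hc : (lam * c - D) / (2 * lam) = (1/2) * c - (1/(2*lam)) * D := by
    field_simp
  have := div_le_div_of_nonneg_right h hpos.le
  rw [kruzEta, hu, abs_div, abs_of_pos hpos]
  linarith

/-- Entropy wave speed for scalar equations (Lemma 4.2): for every
`λ ≥ max(λ(k), λ_ε)` the Kružkov entropy inequality
`η_k(ū(λ)) - ½(η_k(u_L) + η_k(u_R)) + (1/(2λ))(q_k(u_R) - q_k(u_L))·n ≤ 0`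
holds. -/
theorem scalar_entropy_wave_speed {d : ℕ} (uL uR : ℝ)
    (f : ℝ → Fin d → ℝ) (hf : Differentiable ℝ f)
    (n : Fin d → ℝ) (hn : n ⬝ᵥ n = 1)
    (lamEps : ℝ) (hlamEps : 0 < lamEps) (k : ℝ) :
    ∀ lam : ℝ, max (lamK f k n uL uR) lamEps ≤ lam →
      kruzEta k (ubarS f n uL uR lam)
        - (1/2) * (kruzEta k uL + kruzEta k uR)
        + (1/(2*lam)) * ((kruzQ f k uR - kruzQ f k uL) ⬝ᵥ n) ≤ 0 := by
  intro lam hlam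
  obtain ⟨hK, hEps⟩ := max_le_iff.1 hlam
  have hpos : 0 < lam := hlamEps.trans_le hEps
  refine entropy_ineq_of_abs_le f n k hpos ?_
  by_cases hk : k ∈ Set.Ioo (min uL uR) (max uL uR)
  · rw [lamK, if_pos hk] at hK
    obtain ⟨⟨h₁, h₂⟩, -⟩ := (max_le_iff.1 hK).imp_left max_le_iff.1
    have hca : 0 < kruzEta k uL + kruzEta k uR + (uL + uR - 2 * k) ∧
        0 < kruzEta k uL + kruzEta k uR - (uL + uR - 2 * k) := by
      obtain ⟨hmin, hmax⟩ := hk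
      unfold kruzEta
      have := le_abs_self (uL - k)
      have := neg_le_abs (uL - k)
      have := le_abs_self (uR - k)
      have := neg_le_abs (uR - k)
      rcases min_lt_iff.1 hmin with _ | _ <;> rcases lt_max_iff.1 hmax with _ | _ <;>
        constructor <;> linarith
    rw [div_le_iff₀ hca.1] at h₁
    rw [div_le_iff₀ hca.2] at h₂
    rw [abs_le]
    constructor <;> linarith
  · have hb := abs_jump_le_of_lam12_le f n ((lam12_le_lamK f k n uL uR).trans hK)
    have hcases : (k ≤ uL ∧ k ≤ uR) ∨ (uL ≤ k ∧ uR ≤ k) := by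
      rw [Set.mem_Ioo, not_and_or, not_lt, not_lt, le_min_iff, max_le_iff] at hk
      exact hk
    rcases hcases with ⟨hL, hR⟩ | ⟨hL, hR⟩
    · have hu : |uR - uL| ≤ uL + uR - 2 * k := abs_le.2 ⟨by linarith, by linarith⟩
      have hle := abs_le.1 (hb.trans (mul_le_mul_of_nonneg_left hu hpos.le))
      simp only [sub_dotProduct, kruzQ_dotProduct_of_le f n hL, kruzQ_dotProduct_of_le f n hR,
        kruzEta, abs_of_nonneg (sub_nonneg.2 hL), abs_of_nonneg (sub_nonneg.2 hR)] at hle ⊢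
      exact abs_le.2 ⟨by linarith, by linarith⟩
    · have hu : |uR - uL| ≤ -(uL + uR - 2 * k) := abs_le.2 ⟨by linarith, by linarith⟩
      have hle := abs_le.1 (hb.trans (mul_le_mul_of_nonneg_left hu hpos.le))
      simp only [sub_dotProduct, kruzQ_dotProduct_of_ge f n hL, kruzQ_dotProduct_of_ge f n hR,
        kruzEta, abs_of_nonpos (sub_nonpos.2 hL), abs_of_nonpos (sub_nonpos.2 hR)] at hle ⊢
      exact abs_le.2 ⟨by linarith, by linarith⟩
end

section
/- Properties of the Riemann function φ for the p-system with gamma-law pressure: let r > 0, γ > 1, p(v) = r v^{−γ}, and fix v_L, v_R > 0 and u_L, u_R ∈ ℝ. Then φ(v) := f_L(v) + f_R(v) + u_L − u_R is strictly increasing and concave on (0,∞), φ(v) → −∞ as v → 0⁺, and φ(v) → w_+(v_L,u_L) − w_−(v_R,u_R) as v → ∞, where w_+(v,u) = u + (2√(rγ)/(γ−1)) v^{(1−γ)/2} and w_−(v,u) = u − (2√(rγ)/(γ−1)) v^{(1−γ)/2}. -/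
open Filter

/-- For the p-system with pressure `p(v) = r v^{-γ}` and a state with
specific volume `vZ > 0`, the function
`f_Z(v) := -√((p(v) - p(vZ))(vZ - v))` for `v ≤ vZ` and
`f_Z(v) := ∫_{vZ}^v √(-p'(ξ)) dξ = (2√(rγ)/(γ-1))(vZ^{(1-γ)/2} - v^{(1-γ)/2})`
for `v > vZ`. -/
noncomputable def fZ (r γ vZ v : ℝ) : ℝ :=
  if v ≤ vZ then -Real.sqrt ((r * v ^ (-γ) - r * vZ ^ (-γ)) * (vZ - v))
  else 2 * Real.sqrt (r * γ) / (γ - 1) * (vZ ^ ((1 - γ)/2) - v ^ ((1 - γ)/2))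

open Set MeasureTheory

/-- The Cauchy–Schwarz inequality for continuous functions on `[0, 1]`. -/
theorem integral_mul_le_sqrt_mul_sqrt {f g : ℝ → ℝ} (hf : ContinuousOn f (Icc 0 1))
    (hg : ContinuousOn g (Icc 0 1)) :
    ∫ t in (0:ℝ)..1, f t * g t ≤
      √(∫ t in (0:ℝ)..1, f t ^ 2) * √(∫ t in (0:ℝ)..1, g t ^ 2) := by
  rw [← uIcc_of_le zero_le_one] at hf hg
  have hff : IntervalIntegrable (fun t => f t ^ 2) volume 0 1 := (hf.pow 2).intervalIntegrable
  have hgg : IntervalIntegrable (fun t => g t ^ 2) volume 0 1 := (hg.pow 2).intervalIntegrable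
  have hfg : IntervalIntegrable (fun t => f t * g t) volume 0 1 := (hf.mul hg).intervalIntegrable
  have hF : 0 ≤ ∫ t in (0:ℝ)..1, f t ^ 2 :=
    intervalIntegral.integral_nonneg zero_le_one fun _ _ => sq_nonneg _
  rw [← Real.sqrt_mul hF]
  apply Real.le_sqrt_of_sq_le
  have key : ∀ x : ℝ, 0 ≤ (∫ t in (0:ℝ)..1, f t ^ 2) * (x * x)
      + (-2 * ∫ t in (0:ℝ)..1, f t * g t) * x + ∫ t in (0:ℝ)..1, g t ^ 2 := by
    intro x
    have h : 0 ≤ ∫ t in (0:ℝ)..1, (x * f t - g t) ^ 2 :=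
      intervalIntegral.integral_nonneg zero_le_one fun _ _ => sq_nonneg _
    have e : ∫ t in (0:ℝ)..1, (x * f t - g t) ^ 2
        = ∫ t in (0:ℝ)..1, ((x * x) * f t ^ 2 + (-2 * x) * (f t * g t) + g t ^ 2) := by
      congr 1; ext t; ring
    rw [e, intervalIntegral.integral_add ((hff.const_mul _).add (hfg.const_mul _)) hgg,
      intervalIntegral.integral_add (hff.const_mul _) (hfg.const_mul _),
      intervalIntegral.integral_const_mul, intervalIntegral.integral_const_mul] at h
    linarith
  have := discrim_le_zero key
  rw [discrim] at this
  linarith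

/-- The `L²` norm of a nonnegative family of convex functions is convex. -/
theorem ConvexOn.sqrt_integral_sq {S : Set ℝ} {K : ℝ → ℝ → ℝ} (hS : Convex ℝ S)
    (hK : ∀ t ∈ Icc (0:ℝ) 1, ConvexOn ℝ S fun v => K v t)
    (hK₀ : ∀ v ∈ S, ∀ t ∈ Icc (0:ℝ) 1, 0 ≤ K v t)
    (hc : ∀ v ∈ S, ContinuousOn (K v) (Icc 0 1)) :
    ConvexOn ℝ S fun v => √(∫ t in (0:ℝ)..1, K v t ^ 2) := by
  refine ⟨hS, fun x hx y hy a b ha hb hab => ?_⟩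
  have hz := hS hx hy ha hb hab
  have hi : ∀ {f g : ℝ → ℝ}, ContinuousOn f (Icc 0 1) → ContinuousOn g (Icc 0 1) →
      IntervalIntegrable (fun t => f t * g t) volume 0 1 := fun hf hg =>
    ContinuousOn.intervalIntegrable (by rw [uIcc_of_le zero_le_one]; exact hf.mul hg)
  have hi2 : ∀ {f : ℝ → ℝ}, ContinuousOn f (Icc 0 1) →
      IntervalIntegrable (fun t => f t ^ 2) volume 0 1 := fun hf => by
    simpa only [sq] using hi hf hf
  have hcs := integral_mul_le_sqrt_mul_sqrt (hc x hx) (hc y hy)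
  have hA : 0 ≤ ∫ t in (0:ℝ)..1, K x t ^ 2 :=
    intervalIntegral.integral_nonneg zero_le_one fun _ _ => sq_nonneg _
  have hB : 0 ≤ ∫ t in (0:ℝ)..1, K y t ^ 2 :=
    intervalIntegral.integral_nonneg zero_le_one fun _ _ => sq_nonneg _
  simp only [smul_eq_mul] at hz ⊢
  apply Real.sqrt_le_iff.2 ⟨by positivity, ?_⟩
  have hmono : ∫ t in (0:ℝ)..1, K (a * x + b * y) t ^ 2
      ≤ ∫ t in (0:ℝ)..1, (a ^ 2 * K x t ^ 2 + (2 * a * b) * (K x t * K y t)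
        + b ^ 2 * K y t ^ 2) := by
    refine intervalIntegral.integral_mono_on zero_le_one (hi2 (hc _ hz))
      ((((hi2 (hc x hx)).const_mul _).add ((hi (hc x hx) (hc y hy)).const_mul _)).add
        ((hi2 (hc y hy)).const_mul _)) fun t ht => ?_
    have h := (hK t ht).2 hx hy ha hb hab
    simp only [smul_eq_mul] at h
    calc _ ≤ (a * K x t + b * K y t) ^ 2 := pow_le_pow_left₀ (hK₀ _ hz t ht) h 2
      _ = _ := by ring
  rw [intervalIntegral.integral_add
    (((hi2 (hc x hx)).const_mul _).add ((hi (hc x hx) (hc y hy)).const_mul _))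
    ((hi2 (hc y hy)).const_mul _), intervalIntegral.integral_add ((hi2 (hc x hx)).const_mul _)
    ((hi (hc x hx) (hc y hy)).const_mul _), intervalIntegral.integral_const_mul,
    intervalIntegral.integral_const_mul, intervalIntegral.integral_const_mul] at hmono
  have h2 := mul_le_mul_of_nonneg_left hcs (by positivity : 0 ≤ 2 * a * b)
  calc _ ≤ _ := hmono
    _ ≤ a ^ 2 * √(∫ t in (0:ℝ)..1, K x t ^ 2) ^ 2
        + 2 * a * b * (√(∫ t in (0:ℝ)..1, K x t ^ 2) * √(∫ t in (0:ℝ)..1, K y t ^ 2))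
        + b ^ 2 * √(∫ t in (0:ℝ)..1, K y t ^ 2) ^ 2 := by
      rw [Real.sq_sqrt hA, Real.sq_sqrt hB]; linarith
    _ = _ := by ring

theorem convexOn_rpow_of_nonpos {p : ℝ} (hp : p ≤ 0) :
    ConvexOn ℝ (Ioi 0) fun x : ℝ => x ^ p := by
  refine ⟨convex_Ioi 0, fun x hx y hy a b ha hb hab => ?_⟩
  have hz := (convex_Ioi (0:ℝ)) hx hy ha hb hab
  have hl := strictConcaveOn_log_Ioi.concaveOn.2 hx hy ha hb hab
  have he := convexOn_exp.2 (mem_univ (Real.log x * p)) (mem_univ (Real.log y * p)) ha hb hab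
  simp only [smul_eq_mul] at *
  rw [Real.rpow_def_of_pos hx, Real.rpow_def_of_pos hy, Real.rpow_def_of_pos hz]
  refine le_trans (Real.exp_le_exp.2 ?_) he
  nlinarith

theorem segment_pos {w v t : ℝ} (hv : 0 < v) (hvw : v ≤ w) (ht : t ∈ Icc (0:ℝ) 1) :
    0 < w - t * (w - v) := by
  nlinarith [mul_le_mul_of_nonneg_right ht.2 (sub_nonneg.2 hvw)]

theorem continuousOn_segment_rpow {w v : ℝ} (hv : 0 < v) (hvw : v ≤ w) (s : ℝ) :
    ContinuousOn (fun t : ℝ => (w - v) * (w - t * (w - v)) ^ s) (Icc 0 1) := by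
  refine continuousOn_const.mul (ContinuousOn.rpow_const (by fun_prop) fun t ht => ?_)
  exact Or.inl (segment_pos hv hvw ht).ne'

theorem integral_segment_rpow {w v s : ℝ} (hv : 0 < v) (hvw : v ≤ w) (hs : s + 1 ≠ 0) :
    ∫ t in (0:ℝ)..1, (w - v) * (w - t * (w - v)) ^ s = (w ^ (s + 1) - v ^ (s + 1)) / (s + 1) := by
  have hd : ∀ t ∈ uIcc (0:ℝ) 1, HasDerivAt (fun t => -((w - t * (w - v)) ^ (s + 1) / (s + 1)))
      ((w - v) * (w - t * (w - v)) ^ s) t := by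
    intro t ht
    rw [uIcc_of_le zero_le_one] at ht
    have h1 : HasDerivAt (fun t : ℝ => w - t * (w - v)) (-(w - v)) t := by
      simpa using ((hasDerivAt_id t).mul_const (w - v)).const_sub w
    have h2 := ((h1.rpow_const (p := s + 1)
      (Or.inl (segment_pos hv hvw ht).ne')).div_const (s + 1)).neg
    refine h2.congr_deriv ?_
    rw [add_sub_cancel_right]
    field_simp
  rw [intervalIntegral.integral_eq_sub_of_hasDerivAt hd (ContinuousOn.intervalIntegrable (by
    rw [uIcc_of_le zero_le_one]; exact continuousOn_segment_rpow hv hvw s))]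
  simp only [one_mul, zero_mul, sub_zero, sub_sub_cancel]
  ring

/-- The shock branch as a multiple of the `L²` norm of a family of convex functions. -/
theorem fZ_eq_neg_sqrt_integral {r γ w v : ℝ} (hr : 0 < r) (hγ : 1 < γ) (hv : 0 < v)
    (hvw : v ≤ w) :
    fZ r γ w v = -(√(r * γ) *
      √(∫ t in (0:ℝ)..1, ((w - v) * (w - t * (w - v)) ^ (-(γ + 1) / 2)) ^ 2)) := by
  have e : ∫ t in (0:ℝ)..1, ((w - v) * (w - t * (w - v)) ^ (-(γ + 1) / 2)) ^ 2
      = ∫ t in (0:ℝ)..1, (w - v) * ((w - v) * (w - t * (w - v)) ^ (-γ - 1)) := by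
    refine intervalIntegral.integral_congr fun t ht => ?_
    rw [uIcc_of_le zero_le_one] at ht
    have hp := segment_pos hv hvw ht
    rw [mul_pow, ← Real.rpow_mul_natCast hp.le]
    rw [show -(γ + 1) / 2 * ((2:ℕ):ℝ) = -γ - 1 by push_cast; ring]
    ring
  rw [fZ, if_pos hvw, e, intervalIntegral.integral_const_mul,
    integral_segment_rpow hv hvw (by linarith),
    ← Real.sqrt_mul (by positivity), sub_add_cancel]
  congr 2
  field_simp
  ring

theorem fZ_of_ge (r γ : ℝ) {w v : ℝ} (h : w ≤ v) :
    fZ r γ w v = 2 * √(r * γ) / (γ - 1) * (w ^ ((1 - γ)/2) - v ^ ((1 - γ)/2)) := by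
  rcases h.eq_or_lt with rfl | h
  · simp [fZ]
  · rw [fZ, if_neg h.not_ge]

theorem fZ_le_rarefaction {r γ w v : ℝ} (hr : 0 < r) (hγ : 1 < γ) (hv : 0 < v) :
    fZ r γ w v ≤ 2 * √(r * γ) / (γ - 1) * (w ^ ((1 - γ)/2) - v ^ ((1 - γ)/2)) := by
  rcases le_total w v with h | hvw
  · rw [fZ_of_ge r γ h]
  have hcs := integral_mul_le_sqrt_mul_sqrt
    (continuousOn_segment_rpow hv hvw (-(γ + 1) / 2)) (continuousOn_const (c := (1:ℝ)))
  simp only [mul_one, one_pow, intervalIntegral.integral_const, sub_zero, smul_eq_mul,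
    Real.sqrt_one] at hcs
  rw [integral_segment_rpow hv hvw (by linarith),
    show -(γ + 1) / 2 + 1 = (1 - γ) / 2 by ring] at hcs
  rw [fZ_eq_neg_sqrt_integral hr hγ hv hvw]
  have h := mul_le_mul_of_nonneg_left hcs (Real.sqrt_nonneg (r * γ))
  have e : 2 * √(r * γ) / (γ - 1) * (w ^ ((1 - γ)/2) - v ^ ((1 - γ)/2))
      = -(√(r * γ) * ((w ^ ((1 - γ)/2) - v ^ ((1 - γ)/2)) / ((1 - γ) / 2))) := by
    have h1 : γ - 1 ≠ 0 := by linarith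
    have h2 : 1 - γ ≠ 0 := by linarith
    field_simp
    ring
  rw [e]
  linarith

theorem concaveOn_rarefaction {r γ : ℝ} (hγ : 1 < γ) (w : ℝ) :
    ConcaveOn ℝ (Ioi 0) fun v : ℝ =>
      2 * √(r * γ) / (γ - 1) * (w ^ ((1 - γ)/2) - v ^ ((1 - γ)/2)) := by
  have hc : 0 ≤ 2 * √(r * γ) / (γ - 1) := div_nonneg (by positivity) (by linarith)
  exact ((concaveOn_const _ (convex_Ioi 0)).sub
    (convexOn_rpow_of_nonpos (by linarith : (1 - γ) / 2 ≤ 0))).smul hc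

theorem concaveOn_fZ_Ioc {r γ w : ℝ} (hr : 0 < r) (hγ : 1 < γ) :
    ConcaveOn ℝ (Ioc 0 w) (fZ r γ w) := by
  have hp : -(γ + 1) / 2 ≤ 0 := by linarith
  have h : ConvexOn ℝ (Ioc 0 w) fun v =>
      √(∫ t in (0:ℝ)..1, ((w - v) * (w - t * (w - v)) ^ (-(γ + 1) / 2)) ^ 2) := by
    refine ConvexOn.sqrt_integral_sq (convex_Ioc 0 w) (fun t ht => ?_) (fun v hv t ht => ?_)
      fun v hv => continuousOn_segment_rpow hv.1 hv.2 _
    · refine ConvexOn.mul (f := fun v => w - v)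
        (g := fun v => (w - t * (w - v)) ^ (-(γ + 1) / 2)) ?_ ?_ ?_ ?_ ?_
      · exact (convexOn_const _ (convex_Ioc 0 w)).sub (concaveOn_id (convex_Ioc 0 w))
      · refine ⟨convex_Ioc 0 w, fun x hx y hy a b ha hb hab => ?_⟩
        have h := (convexOn_rpow_of_nonpos hp).2 (segment_pos hx.1 hx.2 ht)
          (segment_pos hy.1 hy.2 ht) ha hb hab
        convert h using 2
        simp only [smul_eq_mul]
        linear_combination (t * w - w) * hab
      · exact fun v hv => sub_nonneg.2 hv.2
      · exact fun v hv => Real.rpow_nonneg (segment_pos hv.1 hv.2 ht).le _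
      · refine AntitoneOn.monovaryOn (fun x _ y _ hxy => ?_) fun x hx y hy hxy => ?_
        · exact sub_le_sub_left hxy w
        · refine Real.rpow_le_rpow_of_nonpos (segment_pos hx.1 hx.2 ht) ?_ hp
          nlinarith [ht.1]
    · exact mul_nonneg (sub_nonneg.2 hv.2)
        (Real.rpow_nonneg (segment_pos hv.1 hv.2 ht).le _)
  exact (h.smul (Real.sqrt_nonneg (r * γ))).neg.congr fun v hv =>
    (fZ_eq_neg_sqrt_integral hr hγ hv.1 hv.2).symm

/-- A function lying below a concave function `R` on `(0, ∞)`, equal to `R` beyond `w` and concave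
up to `w`, is concave. -/
theorem concaveOn_Ioi_of_le {f R : ℝ → ℝ} {w : ℝ} (hw : 0 < w) (hR : ConcaveOn ℝ (Ioi 0) R)
    (hf : ConcaveOn ℝ (Ioc 0 w) f) (hle : ∀ v, 0 < v → f v ≤ R v) (heq : ∀ v, w ≤ v → f v = R v) :
    ConcaveOn ℝ (Ioi 0) f := by
  have hge : ∀ {x y a b : ℝ}, 0 < x → 0 < y → 0 ≤ a → 0 ≤ b → a + b = 1 → w ≤ a * x + b * y →
      a * f x + b * f y ≤ f (a * x + b * y) := by
    intro x y a b hx hy ha hb hab h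
    rw [heq _ h]
    have h1 := hR.2 (mem_Ioi.2 hx) (mem_Ioi.2 hy) ha hb hab
    simp only [smul_eq_mul] at h1
    nlinarith [mul_le_mul_of_nonneg_left (hle x hx) ha, mul_le_mul_of_nonneg_left (hle y hy) hb]
  refine LinearOrder.concaveOn_of_lt (convex_Ioi 0) fun x hx y hy hxy a b ha hb hab => ?_
  simp only [smul_eq_mul, mem_Ioi] at *
  rcases le_or_gt w (a * x + b * y) with hz | hz
  · exact hge hx hy ha.le hb.le hab hz
  rcases le_or_gt y w with hyw | hyw
  · exact hf.2 ⟨hx, hxy.le.trans hyw⟩ ⟨hy, hyw⟩ ha.le hb.le hab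
  have hxz : x < a * x + b * y := by nlinarith
  have hxw : x < w := hxz.trans hz
  have hyx : 0 < y - x := by linarith
  have hwx : 0 < w - x := by linarith
  -- `w` on the chord from `x` to `y`, then `a * x + b * y` on the chord from `x` to `w`
  have h1 := hge (a := (y - w) / (y - x)) (b := (w - x) / (y - x)) hx hy
    (div_nonneg (by linarith) hyx.le) (by positivity) (by field_simp; ring)
    (le_of_eq (by field_simp; ring))
  rw [show (y - w) / (y - x) * x + (w - x) / (y - x) * y = w by field_simp; ring] at h1
  have hbz : b * (y - x) = (a * x + b * y) - x := by linear_combination (-x) * hab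
  have hc : 0 ≤ b * (y - x) / (w - x) := by positivity
  have hc' : 0 ≤ 1 - b * (y - x) / (w - x) := by
    rw [sub_nonneg, div_le_one hwx]; linarith
  have h2 := hf.2 ⟨hx, hxw.le⟩ ⟨hw, le_rfl⟩ hc' hc (sub_add_cancel _ _)
  simp only [smul_eq_mul] at h2
  rw [show (1 - b * (y - x) / (w - x)) * x + b * (y - x) / (w - x) * w = a * x + b * y by
    linear_combination div_mul_cancel₀ (b * (y - x)) hwx.ne' - x * hab] at h2
  refine le_trans ?_ h2
  have h3 := mul_le_mul_of_nonneg_left h1 hc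
  refine le_trans (le_of_eq ?_) (add_le_add_right h3 _)
  obtain rfl : a = 1 - b := by linarith
  field_simp
  ring

theorem concaveOn_fZ {r γ w : ℝ} (hr : 0 < r) (hγ : 1 < γ) (hw : 0 < w) :
    ConcaveOn ℝ (Ioi 0) (fZ r γ w) :=
  concaveOn_Ioi_of_le hw (concaveOn_rarefaction hγ w) (concaveOn_fZ_Ioc hr hγ)
    (fun _ hv => fZ_le_rarefaction hr hγ hv) fun _ hv => fZ_of_ge r γ hv

theorem strictMonoOn_fZ {r γ w : ℝ} (hr : 0 < r) (hγ : 1 < γ) (hw : 0 < w) :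
    StrictMonoOn (fZ r γ w) (Ioi 0) := by
  have h1 : StrictMonoOn (fZ r γ w) (Ioc 0 w) := by
    intro x hx y hy hxy
    simp only [fZ, if_pos hx.2, if_pos hy.2]
    have hxp : y ^ (-γ) < x ^ (-γ) := Real.rpow_lt_rpow_of_neg hx.1 hxy (by linarith)
    have hyp : w ^ (-γ) ≤ y ^ (-γ) := Real.rpow_le_rpow_of_nonpos hy.1 hy.2 (by linarith)
    have hxp' := mul_lt_mul_of_pos_left hxp hr
    have hyp' := mul_le_mul_of_nonneg_left hyp hr.le
    refine neg_lt_neg (Real.sqrt_lt_sqrt (mul_nonneg (by linarith) (by linarith [hy.2])) ?_)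
    exact mul_lt_mul'' (by linarith) (by linarith) (by linarith) (by linarith [hy.2])
  have h2 : StrictMonoOn (fZ r γ w) (Ici w) := by
    intro x hx y hy hxy
    rw [fZ_of_ge r γ hx, fZ_of_ge r γ hy]
    have hc : 0 < 2 * √(r * γ) / (γ - 1) := by
      have : 0 < γ := by linarith
      exact div_pos (by positivity) (by linarith)
    have h := Real.rpow_lt_rpow_of_neg (hw.trans_le hx) hxy (by linarith : (1 - γ) / 2 < 0)
    exact mul_lt_mul_of_pos_left (by linarith) hc
  have h := h1.union h2 (isGreatest_Ioc hw) isLeast_Ici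
  rwa [Ioc_union_Ici_eq_Ioi hw] at h

theorem tendsto_fZ_nhdsGT_zero {r γ : ℝ} (hr : 0 < r) (hγ : 1 < γ) (w : ℝ) :
    Tendsto (fZ r γ w) (nhdsWithin 0 (Ioi 0)) atBot := by
  have hc : 0 < 2 * √(r * γ) / (γ - 1) := by
    have : 0 < γ := by linarith
    exact div_pos (by positivity) (by linarith)
  refine tendsto_atBot_mono' _ (eventually_mem_nhdsWithin.mono fun v hv =>
    fZ_le_rarefaction hr hγ hv) (Tendsto.const_mul_atBot hc ?_)
  simp only [sub_eq_add_neg]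
  exact tendsto_atBot_add_const_left _ _ (tendsto_neg_atTop_atBot.comp
    (tendsto_rpow_neg_nhdsGT_zero (by linarith)))

theorem tendsto_fZ_atTop {γ : ℝ} (r : ℝ) (hγ : 1 < γ) (w : ℝ) :
    Tendsto (fZ r γ w) atTop (nhds (2 * √(r * γ) / (γ - 1) * w ^ ((1 - γ)/2))) := by
  have h := tendsto_rpow_neg_atTop (by linarith : 0 < (γ - 1) / 2)
  rw [show -((γ - 1) / 2) = (1 - γ) / 2 by ring] at h
  have h2 := (h.const_sub (w ^ ((1 - γ)/2))).const_mul (2 * √(r * γ) / (γ - 1))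
  rw [sub_zero] at h2
  exact h2.congr' ((eventually_ge_atTop w).mono fun v hv => (fZ_of_ge r γ hv).symm)

/-- Properties of the Riemann function `φ(v) := f_L(v) + f_R(v) + u_L - u_R`
for the p-system with gamma-law pressure `p(v) = r v^{-γ}` (`r > 0`, `γ > 1`):
`φ` is strictly increasing and concave on `(0,∞)`, `φ(v) → -∞` as `v → 0⁺`,
and `φ(v) → w_+(v_L,u_L) - w_-(v_R,u_R)` as `v → ∞`, where
`w_±(v,u) = u ± (2√(rγ)/(γ-1)) v^{(1-γ)/2}`. -/
theorem p_system_phi_properties (r γ : ℝ) (hr : 0 < r) (hγ : 1 < γ)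
    (vL vR : ℝ) (hvL : 0 < vL) (hvR : 0 < vR) (uL uR : ℝ) :
    StrictMonoOn (fun v : ℝ => fZ r γ vL v + fZ r γ vR v + uL - uR)
      (Set.Ioi (0:ℝ)) ∧
    ConcaveOn ℝ (Set.Ioi (0:ℝ))
      (fun v : ℝ => fZ r γ vL v + fZ r γ vR v + uL - uR) ∧
    Tendsto (fun v : ℝ => fZ r γ vL v + fZ r γ vR v + uL - uR)
      (nhdsWithin 0 (Set.Ioi (0:ℝ))) atBot ∧
    Tendsto (fun v : ℝ => fZ r γ vL v + fZ r γ vR v + uL - uR) atTop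
      (nhds ((uL + 2 * Real.sqrt (r * γ) / (γ - 1) * vL ^ ((1 - γ)/2))
        - (uR - 2 * Real.sqrt (r * γ) / (γ - 1) * vR ^ ((1 - γ)/2)))) := by
  refine ⟨fun x hx y hy hxy => ?_, ?_, ?_, ?_⟩
  · have h1 := strictMonoOn_fZ hr hγ hvL hx hy hxy
    have h2 := strictMonoOn_fZ hr hγ hvR hx hy hxy
    simp only
    linarith
  · simp only [add_sub_assoc]
    exact ((concaveOn_fZ hr hγ hvL).add (concaveOn_fZ hr hγ hvR)).add_const (uL - uR)
  · simp only [add_sub_assoc]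
    exact tendsto_atBot_add_const_right _ _
      ((tendsto_fZ_nhdsGT_zero hr hγ vL).atBot_add_atBot (tendsto_fZ_nhdsGT_zero hr hγ vR))
  · convert (((tendsto_fZ_atTop r hγ vL).add (tendsto_fZ_atTop r hγ vR)).add_const uL).sub_const uR
      using 2
    ring
end

section
/- Entropy wave speed for the square entropy (formula in the robustness remark): let u_L, u_R ∈ ℝ with u_L ≠ u_R, f : ℝ → ℝ^d, q : ℝ → ℝ^d, and n ∈ ℝ^d a unit vector. Set a := ½(u_L + u_R), b := ½(f(u_L) − f(u_R))·n, c := ½u_L² + ½u_R², d' := (q(u_R) − q(u_L))·n, and Δ := (2ab + d')² − 4b²(a² − c). Then c − a² = ¼(u_L − u_R)² > 0, Δ ≥ 0, and for every λ > 0 with λ ≥ (2ab + d' + √Δ)/(2(c − a²)), the square-entropy inequality holds: ½(a + b/λ)² ≤ ½c − d'/(2λ); that is, η(ū(λ)) ≤ ½(η(u_L) + η(u_R)) − (1/(2λ))(q(u_R) − q(u_L))·n for η(v) = ½v² and ū(λ) = ½(u_L + u_R) − (1/(2λ))(f(u_R) − f(u_L))·n. -/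
open Matrix

/-- A number beyond the larger root of `K x² - P x - b²`, with `K > 0`, makes this polynomial
nonnegative. -/
theorem quadratic_nonneg_of_larger_root_le {K P b x : ℝ} (hK : 0 < K)
    (hx : (P + Real.sqrt (P ^ 2 + 4 * b ^ 2 * K)) / (2 * K) ≤ x) :
    0 ≤ K * x ^ 2 - P * x - b ^ 2 := by
  have hD : 0 ≤ P ^ 2 + 4 * b ^ 2 * K := by positivity
  rw [div_le_iff₀ (by positivity)] at hx
  have hsq : Real.sqrt (P ^ 2 + 4 * b ^ 2 * K) ^ 2 ≤ (2 * K * x - P) ^ 2 :=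
    pow_le_pow_left₀ (Real.sqrt_nonneg _) (by linarith) 2
  rw [Real.sq_sqrt hD] at hsq
  have h : 0 ≤ 4 * K * (K * x ^ 2 - P * x - b ^ 2) := by linarith
  exact nonneg_of_mul_nonneg_right h (by positivity)

/-- The square-entropy inequality holds for every wave speed beyond the larger root of the
associated quadratic. -/
theorem half_sq_add_div_le {a b c e x : ℝ} (hK : 0 < c - a ^ 2) (hx : 0 < x)
    (h : (2 * a * b + e + Real.sqrt ((2 * a * b + e) ^ 2 - 4 * b ^ 2 * (a ^ 2 - c)))
      / (2 * (c - a ^ 2)) ≤ x) :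
    (1 / 2) * (a + b / x) ^ 2 ≤ (1 / 2) * c - e / (2 * x) := by
  rw [show (2 * a * b + e) ^ 2 - 4 * b ^ 2 * (a ^ 2 - c)
    = (2 * a * b + e) ^ 2 + 4 * b ^ 2 * (c - a ^ 2) by ring] at h
  have hq := quadratic_nonneg_of_larger_root_le hK h
  have hdiff : (1 / 2) * c - e / (2 * x) - (1 / 2) * (a + b / x) ^ 2
      = ((c - a ^ 2) * x ^ 2 - (2 * a * b + e) * x - b ^ 2) / (2 * x ^ 2) := by
    field_simp
    ring
  rw [← sub_nonneg, hdiff]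
  positivity

/-- Entropy wave speed for the square entropy `η(v) = ½v²`: with
`a := ½(u_L + u_R)`, `b := ½(f(u_L) - f(u_R))·n`, `c := ½u_L² + ½u_R²`,
`d' := (q(u_R) - q(u_L))·n`, `Δ := (2ab + d')² - 4b²(a² - c)`, one has
`c - a² = ¼(u_L - u_R)² > 0`, `Δ ≥ 0`, and for every `λ > 0` with
`λ ≥ (2ab + d' + √Δ)/(2(c - a²))` the square-entropy inequality
`½(a + b/λ)² ≤ ½c - d'/(2λ)` holds, i.e.
`η(ū(λ)) ≤ ½(η(u_L) + η(u_R)) - (1/(2λ))(q(u_R) - q(u_L))·n`. -/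
theorem square_entropy_wave_speed {d : ℕ} (uL uR : ℝ) (hne : uL ≠ uR)
    (f q : ℝ → Fin d → ℝ) (n : Fin d → ℝ) (hn : n ⬝ᵥ n = 1) :
    (1/2)*uL^2 + (1/2)*uR^2 - ((uL + uR)/2)^2 = (1/4)*(uL - uR)^2 ∧
    0 < (1/2)*uL^2 + (1/2)*uR^2 - ((uL + uR)/2)^2 ∧
    0 ≤ (2*((uL + uR)/2)*(((f uL - f uR) ⬝ᵥ n)/2) + (q uR - q uL) ⬝ᵥ n)^2
      - 4*(((f uL - f uR) ⬝ᵥ n)/2)^2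
        * (((uL + uR)/2)^2 - ((1/2)*uL^2 + (1/2)*uR^2)) ∧
    ∀ lam : ℝ, 0 < lam →
      (2*((uL + uR)/2)*(((f uL - f uR) ⬝ᵥ n)/2) + (q uR - q uL) ⬝ᵥ n
        + Real.sqrt ((2*((uL + uR)/2)*(((f uL - f uR) ⬝ᵥ n)/2)
            + (q uR - q uL) ⬝ᵥ n)^2
          - 4*(((f uL - f uR) ⬝ᵥ n)/2)^2
            * (((uL + uR)/2)^2 - ((1/2)*uL^2 + (1/2)*uR^2))))
        / (2*((1/2)*uL^2 + (1/2)*uR^2 - ((uL + uR)/2)^2)) ≤ lam →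
      (1/2)*((uL + uR)/2 + (((f uL - f uR) ⬝ᵥ n)/2)/lam)^2
          ≤ (1/2)*((1/2)*uL^2 + (1/2)*uR^2) - ((q uR - q uL) ⬝ᵥ n)/(2*lam) ∧
      (1/2)*(ubarS f n uL uR lam)^2
          ≤ (1/2)*((1/2)*uL^2 + (1/2)*uR^2)
            - (1/(2*lam))*((q uR - q uL) ⬝ᵥ n) := by
  have hgap : (1/2)*uL^2 + (1/2)*uR^2 - ((uL + uR)/2)^2 = (1/4)*(uL - uR)^2 := by ring
  have hpos : 0 < (1/2)*uL^2 + (1/2)*uR^2 - ((uL + uR)/2)^2 := by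
    have := sub_ne_zero.mpr hne
    rw [hgap]
    positivity
  refine ⟨hgap, hpos, ?_, fun lam hlam h => ?_⟩
  · nlinarith [mul_nonneg (sq_nonneg (((f uL - f uR) ⬝ᵥ n)/2)) hpos.le,
      sq_nonneg (2*((uL + uR)/2)*(((f uL - f uR) ⬝ᵥ n)/2) + (q uR - q uL) ⬝ᵥ n)]
  · have hmain := half_sq_add_div_le hpos hlam h
    refine ⟨hmain, ?_⟩
    have hu : ubarS f n uL uR lam = (uL + uR)/2 + (((f uL - f uR) ⬝ᵥ n)/2)/lam := by
      rw [ubarS, ← neg_sub (f uL) (f uR), neg_dotProduct]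
      ring
    rw [hu]
    convert hmain using 2
    ring
end
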